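/- Let (s_j)_{j=0}^{2n+1} be nearly first-term dominant. Then the Hankel matrix built from the first α-Schur transform satisfies H_n^{[1,α]} = D_{l,n}^{[+,α]} (H_{α,n} − Θ_{n,2n+1}) D_{r,n}^{[+,α]}, and consequently rank H_n^{[1,α]} = rank(H_{α,n} − Θ_{n,2n+1}); in the square case p = q moreover det H_n^{[1,α]} = (det s_0)(det s_0)^{+} det H_{α,n} = det(H_{α,n} − Θ_{n,2n+1}). -/

import Mathlib

open Matrix BigOperators

def IsMP {m n : Type*} [Fintype m] [Fintype n] (A : Matrix m n ℂ) (B : Matrix n m ℂ) : Prop :=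
  A * B * A = A ∧ B * A * B = B ∧ (A * B)ᴴ = A * B ∧ (B * A)ᴴ = B * A

open Classical in
noncomputable def mp {m n : Type*} [Fintype m] [Fintype n] (A : Matrix m n ℂ) : Matrix n m ℂ :=
  if h : ∃ B, IsMP A B then h.choose else 0

noncomputable def recip {p q : ℕ} (s : ℕ → Matrix (Fin p) (Fin q) ℂ) :
    ℕ → Matrix (Fin q) (Fin p) ℂ
  | 0 => mp (s 0)
  | (j+1) => -(mp (s 0) * ∑ l : Fin (j+1), s (j+1 - l.val) * recip s l.val)
termination_by j => j
decreasing_by exact l.isLt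

noncomputable def shiftA {p q : ℕ} (α : ℂ) (s : ℕ → Matrix (Fin p) (Fin q) ℂ) :
    ℕ → Matrix (Fin p) (Fin q) ℂ
  | 0 => s 0
  | (j+1) => (-α) • s j + s (j+1)

noncomputable def recipA {p q : ℕ} (α : ℂ) (s : ℕ → Matrix (Fin p) (Fin q) ℂ) :
    ℕ → Matrix (Fin q) (Fin p) ℂ :=
  recip (shiftA α s)

/-- the first α-Schur transform. -/
noncomputable def schur1 {p q : ℕ} (α : ℂ) (s : ℕ → Matrix (Fin p) (Fin q) ℂ) :
    ℕ → Matrix (Fin p) (Fin q) ℂ :=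
  fun j => s 0 * (-(recipA α s (j + 1))) * s 0

/-- block Hankel matrix H_n = [u_{j+k}]_{j,k=0}^{n}. -/
def hankelMat {p q : ℕ} (u : ℕ → Matrix (Fin p) (Fin q) ℂ) (n : ℕ) :
    Matrix (Fin (n + 1) × Fin p) (Fin (n + 1) × Fin q) ℂ :=
  Matrix.of fun jk lm => u (jk.1.val + lm.1.val) jk.2 lm.2

/-- the sequence s_{α,j} = -α s_j + s_{j+1}. -/
noncomputable def sA {p q : ℕ} (α : ℂ) (s : ℕ → Matrix (Fin p) (Fin q) ℂ) :
    ℕ → Matrix (Fin p) (Fin q) ℂ :=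
  fun j => (-α) • s j + s (j + 1)

/-- Θ_{n,m} = diag(0_{np×nq}, s_m − s_0 s_0^+ s_m s_0^+ s_0). -/
noncomputable def theta {p q : ℕ} (s : ℕ → Matrix (Fin p) (Fin q) ℂ) (n m : ℕ) :
    Matrix (Fin (n + 1) × Fin p) (Fin (n + 1) × Fin q) ℂ :=
  Matrix.of fun jk lm =>
    if jk.1.val = n ∧ lm.1.val = n then
      (s m - s 0 * mp (s 0) * s m * mp (s 0) * s 0) jk.2 lm.2
    else 0

/-- the block shift matrix T_{p,n}. -/
def Tshift (p n : ℕ) : Matrix (Fin (n + 1) × Fin p) (Fin (n + 1) × Fin p) ℂ :=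
  Matrix.of fun jk lm => if jk.1.val = lm.1.val + 1 ∧ jk.2 = lm.2 then 1 else 0

/-- R_{p,n}(z) = (I − z T_{p,n})^{-1}. -/
noncomputable def Rmat (p n : ℕ) (z : ℂ) :
    Matrix (Fin (n + 1) × Fin p) (Fin (n + 1) × Fin p) ℂ :=
  (1 - z • Tshift p n)⁻¹

/-- the lower triangular block Toeplitz matrix S_n^♯ of the reciprocal sequence. -/
noncomputable def SlowMP {p q : ℕ} (s : ℕ → Matrix (Fin p) (Fin q) ℂ) (n : ℕ) :
    Matrix (Fin (n + 1) × Fin q) (Fin (n + 1) × Fin p) ℂ :=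
  Matrix.of fun jk lm =>
    if lm.1.val ≤ jk.1.val then recip s (jk.1.val - lm.1.val) jk.2 lm.2 else 0

/-- the upper triangular block Toeplitz matrix S̃_n^♯ of the reciprocal sequence. -/
noncomputable def SupMP {p q : ℕ} (s : ℕ → Matrix (Fin p) (Fin q) ℂ) (n : ℕ) :
    Matrix (Fin (n + 1) × Fin q) (Fin (n + 1) × Fin p) ℂ :=
  Matrix.of fun jk lm =>
    if jk.1.val ≤ lm.1.val then recip s (lm.1.val - jk.1.val) jk.2 lm.2 else 0

/-- I_{n+1} ⊗ M. -/
def kronI {a b : ℕ} (n : ℕ) (M : Matrix (Fin a) (Fin b) ℂ) :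
    Matrix (Fin (n + 1) × Fin a) (Fin (n + 1) × Fin b) ℂ :=
  Matrix.of fun jk lm => if jk.1 = lm.1 then M jk.2 lm.2 else 0

/-- D_{l,n}^{[+,α]} = R_{p,n}(α)(I_{n+1}⊗s_0)S_n^♯ + I_{n+1}⊗(I_p − s_0 s_0^+). -/
noncomputable def Dl {p q : ℕ} (α : ℂ) (s : ℕ → Matrix (Fin p) (Fin q) ℂ) (n : ℕ) :
    Matrix (Fin (n + 1) × Fin p) (Fin (n + 1) × Fin p) ℂ :=
  Rmat p n α * kronI n (s 0) * SlowMP s n + kronI n (1 - s 0 * mp (s 0))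

/-- D_{r,n}^{[+,α]} = S̃_n^♯(I_{n+1}⊗s_0)R_{q,n}(conj α)* + I_{n+1}⊗(I_q − s_0^+ s_0). -/
noncomputable def Dr {p q : ℕ} (α : ℂ) (s : ℕ → Matrix (Fin p) (Fin q) ℂ) (n : ℕ) :
    Matrix (Fin (n + 1) × Fin q) (Fin (n + 1) × Fin q) ℂ :=
  SupMP s n * kronI n (s 0) * (Rmat q n (starRingEnd ℂ α))ᴴ + kronI n (1 - mp (s 0) * s 0)

section

open PowerSeries Finset

section MoorePenrose

variable {m n : Type*} [Fintype m] [Fintype n]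

open scoped ComplexOrder in
theorem exists_isMP [DecidableEq n] (A : Matrix m n ℂ) : ∃ B, IsMP A B := by
  have hH : (Aᴴ * A).IsHermitian := isHermitian_conjTranspose_mul_self A
  obtain ⟨G, hG, hHGH, hGHG, hcomm⟩ : ∃ G : Matrix n n ℂ, Gᴴ = G ∧
      Aᴴ * A * G * (Aᴴ * A) = Aᴴ * A ∧ G * (Aᴴ * A) * G = G ∧
      Aᴴ * A * G = G * (Aᴴ * A) := by
    let U : Matrix n n ℂ := hH.eigenvectorUnitary
    let D : Matrix n n ℂ := diagonal fun i => (hH.eigenvalues i : ℂ)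
    let E : Matrix n n ℂ := diagonal fun i => (hH.eigenvalues i : ℂ)⁻¹
    have hU : Uᴴ * U = 1 := Unitary.coe_star_mul_self hH.eigenvectorUnitary
    have hspec : Aᴴ * A = U * D * Uᴴ := hH.spectral_theorem
    have key : ∀ X Y : Matrix n n ℂ, U * X * Uᴴ * (U * Y * Uᴴ) = U * (X * Y) * Uᴴ := by
      intro X Y
      calc U * X * Uᴴ * (U * Y * Uᴴ) = U * X * (Uᴴ * U) * Y * Uᴴ := by
            simp only [Matrix.mul_assoc]
        _ = U * (X * Y) * Uᴴ := by rw [hU]; simp only [Matrix.mul_assoc, Matrix.one_mul]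
    have hDED : D * E * D = D := by
      simp only [D, E, diagonal_mul_diagonal]
      congr 1; ext i
      by_cases h : (hH.eigenvalues i : ℂ) = 0 <;> simp [h]
    have hEDE : E * D * E = E := by
      simp only [D, E, diagonal_mul_diagonal]
      congr 1; ext i
      by_cases h : (hH.eigenvalues i : ℂ) = 0 <;> simp [h]
    have hDE : D * E = E * D := by
      simp only [D, E, diagonal_mul_diagonal, mul_comm]
    have hE : Eᴴ = E := by
      simp only [E, diagonal_conjTranspose]
      congr 1; ext i; simp
    refine ⟨U * E * Uᴴ, ?_, ?_, ?_, ?_⟩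
    · simp [conjTranspose_mul, hE, Matrix.mul_assoc]
    · rw [hspec, key, key, hDED]
    · rw [hspec, key, key, hEDE]
    · rw [hspec, key, key, hDE]
  refine ⟨G * Aᴴ, ?_, ?_, ?_, ?_⟩
  · have h0 : (A * (G * (Aᴴ * A) - 1))ᴴ * (A * (G * (Aᴴ * A) - 1)) = 0 := by
      have : (A * (G * (Aᴴ * A) - 1))ᴴ * A = 0 := by
        rw [conjTranspose_mul, conjTranspose_sub, conjTranspose_mul, hG, hH.eq,
          conjTranspose_one, Matrix.mul_assoc, Matrix.sub_mul, hHGH, Matrix.one_mul, sub_self]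
      rw [← Matrix.mul_assoc, this, Matrix.zero_mul]
    have h1 := conjTranspose_mul_self_eq_zero.mp h0
    rw [Matrix.mul_sub, Matrix.mul_one, sub_eq_zero] at h1
    simpa only [Matrix.mul_assoc] using h1
  · calc G * Aᴴ * A * (G * Aᴴ) = G * (Aᴴ * A) * G * Aᴴ := by simp only [Matrix.mul_assoc]
      _ = G * Aᴴ := by rw [hGHG]
  · simp [conjTranspose_mul, hG, Matrix.mul_assoc]
  · rw [Matrix.mul_assoc, conjTranspose_mul, hG, hH.eq, hcomm]

theorem isMP_mp (A : Matrix m n ℂ) : IsMP A (mp A) := by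
  classical
  have h := exists_isMP A
  rw [mp, dif_pos h]
  exact h.choose_spec

theorem mul_mp_mul_self (A : Matrix m n ℂ) : A * mp A * A = A := (isMP_mp A).1

theorem mp_mul_mul_mp (A : Matrix m n ℂ) : mp A * A * mp A = mp A := (isMP_mp A).2.1

theorem mul_mp_mul_of_range_le {k : Type*} [Fintype k] {A : Matrix m n ℂ} {B : Matrix m k ℂ}
    (h : LinearMap.range B.mulVecLin ≤ LinearMap.range A.mulVecLin) : A * mp A * B = B := by
  classical
  refine Matrix.ext_of_mulVec_single fun i => ?_
  obtain ⟨v, hv⟩ := h ⟨Pi.single i 1, rfl⟩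
  rw [mulVecLin_apply, mulVecLin_apply] at hv
  rw [← mulVec_mulVec, ← hv, mulVec_mulVec, mul_mp_mul_self]

theorem mul_mp_mul_of_ker_le {k : Type*} {A : Matrix m n ℂ} {B : Matrix k n ℂ}
    (h : LinearMap.ker A.mulVecLin ≤ LinearMap.ker B.mulVecLin) : B * (mp A * A) = B := by
  classical
  refine Matrix.ext_of_mulVec_single fun i => ?_
  have hv : (mp A * A) *ᵥ Pi.single i 1 - Pi.single i 1 ∈ LinearMap.ker A.mulVecLin := by
    rw [LinearMap.mem_ker, mulVecLin_apply, mulVec_sub, mulVec_mulVec, ← Matrix.mul_assoc,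
      mul_mp_mul_self, sub_self]
  have := h hv
  rw [LinearMap.mem_ker, mulVecLin_apply, mulVec_sub, mulVec_mulVec, sub_eq_zero] at this
  exact this

end MoorePenrose

section MatrixSeries

variable {l m n : Type*}

/-- The generating series of a sequence of matrices. -/
noncomputable def genSeries (a : ℕ → Matrix m n ℂ) : Matrix m n ℂ⟦X⟧ :=
  Matrix.of fun i j => PowerSeries.mk fun k => a k i j

/-- The matrix of `k`-th coefficients of a matrix of power series. -/
noncomputable def matCoeff (k : ℕ) (F : Matrix m n ℂ⟦X⟧) : Matrix m n ℂ :=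
  F.map (coeff k)

/-- A constant matrix, viewed as a matrix of power series. -/
noncomputable def constSeries (M : Matrix m n ℂ) : Matrix m n ℂ⟦X⟧ :=
  M.map (PowerSeries.C)

theorem matCoeff_ext {F G : Matrix m n ℂ⟦X⟧} (h : ∀ k, matCoeff k F = matCoeff k G) : F = G := by
  ext i j k
  exact congrFun (congrFun (h k) i) j

@[simp] theorem matCoeff_genSeries (a : ℕ → Matrix m n ℂ) (k : ℕ) :
    matCoeff k (genSeries a) = a k := by
  ext i j
  simp [matCoeff, genSeries]

@[simp] theorem matCoeff_add (k : ℕ) (F G : Matrix m n ℂ⟦X⟧) :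
    matCoeff k (F + G) = matCoeff k F + matCoeff k G := by
  ext i j
  simp [matCoeff]

theorem matCoeff_constSeries (k : ℕ) (M : Matrix m n ℂ) :
    matCoeff k (constSeries M) = if k = 0 then M else 0 := by
  ext i j
  by_cases h : k = 0 <;> simp [matCoeff, constSeries, coeff_C, h]

theorem matCoeff_mul [Fintype m] (k : ℕ) (F : Matrix l m ℂ⟦X⟧) (G : Matrix m n ℂ⟦X⟧) :
    matCoeff k (F * G) = ∑ x ∈ antidiagonal k, matCoeff x.1 F * matCoeff x.2 G := by
  ext i j
  simp only [matCoeff, Matrix.map_apply, Matrix.mul_apply, map_sum, PowerSeries.coeff_mul,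
    Matrix.sum_apply]
  exact sum_comm

theorem matCoeff_mul_left [Fintype m] (k : ℕ) (F : Matrix l m ℂ⟦X⟧) (G : Matrix m n ℂ⟦X⟧) :
    matCoeff k (F * G) = ∑ i ∈ range (k + 1), matCoeff i F * matCoeff (k - i) G := by
  rw [matCoeff_mul, Finset.Nat.sum_antidiagonal_eq_sum_range_succ_mk]

theorem matCoeff_mul_right [Fintype m] (k : ℕ) (F : Matrix l m ℂ⟦X⟧) (G : Matrix m n ℂ⟦X⟧) :
    matCoeff k (F * G) = ∑ i ∈ range (k + 1), matCoeff (k - i) F * matCoeff i G := by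
  rw [matCoeff_mul, ← Finset.Nat.sum_antidiagonal_swap,
    Finset.Nat.sum_antidiagonal_eq_sum_range_succ_mk]
  rfl

theorem constSeries_mul [Fintype m] (M : Matrix l m ℂ) (N : Matrix m n ℂ) :
    constSeries (M * N) = constSeries M * constSeries N :=
  Matrix.map_mul

@[simp] theorem matCoeff_constSeries_mul [Fintype m] (k : ℕ) (M : Matrix l m ℂ)
    (F : Matrix m n ℂ⟦X⟧) : matCoeff k (constSeries M * F) = M * matCoeff k F := by
  ext i j
  simp [matCoeff, constSeries, Matrix.mul_apply]

@[simp] theorem matCoeff_mul_constSeries [Fintype m] (k : ℕ) (F : Matrix l m ℂ⟦X⟧)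
    (M : Matrix m n ℂ) : matCoeff k (F * constSeries M) = matCoeff k F * M := by
  ext i j
  simp [matCoeff, constSeries, Matrix.mul_apply]

theorem constSeries_one [DecidableEq m] : constSeries (1 : Matrix m m ℂ) = 1 :=
  Matrix.map_one _ (map_zero _) (map_one _)

end MatrixSeries

section Toeplitz

variable {l m n : Type*}

/-- The block matrix with blocks `f j k`, `0 ≤ j, k ≤ N`. -/
def blockMat (N : ℕ) (f : ℕ → ℕ → Matrix m n ℂ) :
    Matrix (Fin (N + 1) × m) (Fin (N + 1) × n) ℂ :=
  Matrix.of fun x y => f x.1.val y.1.val x.2 y.2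

theorem blockMat_mul [Fintype m] (N : ℕ) (f : ℕ → ℕ → Matrix l m ℂ) (g : ℕ → ℕ → Matrix m n ℂ) :
    blockMat N f * blockMat N g =
      blockMat N fun i k => ∑ j ∈ range (N + 1), f i j * g j k := by
  ext ⟨i, a⟩ ⟨k, b⟩
  simp only [blockMat, Matrix.mul_apply, Matrix.of_apply, Fintype.sum_prod_type,
    Matrix.sum_apply, Finset.sum_range]

theorem blockMat_congr {N : ℕ} {f g : ℕ → ℕ → Matrix m n ℂ}
    (h : ∀ i ≤ N, ∀ k ≤ N, f i k = g i k) : blockMat N f = blockMat N g := by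
  ext ⟨i, a⟩ ⟨k, b⟩
  exact congrFun (congrFun (h i (Nat.lt_succ_iff.mp i.2) k (Nat.lt_succ_iff.mp k.2)) a) b

/-- The lower triangular block Toeplitz matrix of a matrix power series. -/
noncomputable def lowerToeplitz (N : ℕ) (F : Matrix m n ℂ⟦X⟧) :
    Matrix (Fin (N + 1) × m) (Fin (N + 1) × n) ℂ :=
  blockMat N fun j k => if k ≤ j then matCoeff (j - k) F else 0

/-- The upper triangular block Toeplitz matrix of a matrix power series. -/
noncomputable def upperToeplitz (N : ℕ) (F : Matrix m n ℂ⟦X⟧) :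
    Matrix (Fin (N + 1) × m) (Fin (N + 1) × n) ℂ :=
  blockMat N fun j k => if j ≤ k then matCoeff (k - j) F else 0

theorem upperToeplitz_eq_transpose (N : ℕ) (F : Matrix m n ℂ⟦X⟧) :
    upperToeplitz N F = (lowerToeplitz N Fᵀ)ᵀ := by
  ext ⟨i, a⟩ ⟨k, b⟩
  simp only [upperToeplitz, lowerToeplitz, blockMat, Matrix.of_apply, Matrix.transpose_apply]
  split_ifs <;> rfl

theorem sum_range_ite_le {M : Type*} [AddCommMonoid M] {N j : ℕ} (hj : j ≤ N) (f : ℕ → M) :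
    ∑ i ∈ range (N + 1), (if i ≤ j then f i else 0) = ∑ i ∈ range (j + 1), f i := by
  rw [← Finset.sum_filter]
  congr 1
  ext i
  simp only [mem_filter, mem_range]
  omega

theorem lowerToeplitz_mul [Fintype m] (N : ℕ) (F : Matrix l m ℂ⟦X⟧) (G : Matrix m n ℂ⟦X⟧) :
    lowerToeplitz N (F * G) = lowerToeplitz N F * lowerToeplitz N G := by
  rw [lowerToeplitz, lowerToeplitz, lowerToeplitz, blockMat_mul]
  refine blockMat_congr fun j hj k hk => ?_
  by_cases hkj : k ≤ j
  · rw [if_pos hkj]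
    obtain ⟨d, rfl⟩ := Nat.exists_eq_add_of_le hkj
    rw [Finset.sum_congr rfl fun i _ =>
      show (if i ≤ k + d then matCoeff (k + d - i) F else 0) *
          (if k ≤ i then matCoeff (i - k) G else 0) =
        if i ≤ k + d then (if k ≤ i then matCoeff (k + d - i) F * matCoeff (i - k) G else 0)
          else 0 by split_ifs <;> simp]
    rw [sum_range_ite_le hj, add_assoc, Finset.sum_range_add, Finset.sum_eq_zero, zero_add,
      matCoeff_mul_right]
    · rw [show k + d - k = d by omega]
      refine Finset.sum_congr rfl fun i _ => ?_
      rw [if_pos (by omega)]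
      congr 2 <;> omega
    · intro i hi
      rw [if_neg (by have := mem_range.mp hi; omega)]
  · rw [if_neg hkj, Finset.sum_eq_zero]
    intro i _
    by_cases h1 : i ≤ j
    · rw [if_neg (show ¬ k ≤ i by omega), Matrix.mul_zero]
    · rw [if_neg h1, Matrix.zero_mul]

theorem upperToeplitz_mul [Fintype m] (N : ℕ) (F : Matrix l m ℂ⟦X⟧) (G : Matrix m n ℂ⟦X⟧) :
    upperToeplitz N (F * G) = upperToeplitz N F * upperToeplitz N G := by
  rw [upperToeplitz_eq_transpose, upperToeplitz_eq_transpose, upperToeplitz_eq_transpose,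
    Matrix.transpose_mul, lowerToeplitz_mul, Matrix.transpose_mul]

theorem lowerToeplitz_add (N : ℕ) (F G : Matrix m n ℂ⟦X⟧) :
    lowerToeplitz N (F + G) = lowerToeplitz N F + lowerToeplitz N G := by
  ext ⟨i, a⟩ ⟨k, b⟩
  simp only [lowerToeplitz, blockMat, Matrix.of_apply, Matrix.add_apply, matCoeff_add]
  split_ifs <;> simp

theorem upperToeplitz_add (N : ℕ) (F G : Matrix m n ℂ⟦X⟧) :
    upperToeplitz N (F + G) = upperToeplitz N F + upperToeplitz N G := by
  simp only [upperToeplitz_eq_transpose, Matrix.transpose_add, lowerToeplitz_add]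

theorem lowerToeplitz_one [DecidableEq m] (N : ℕ) :
    lowerToeplitz N (1 : Matrix m m ℂ⟦X⟧) = 1 := by
  ext ⟨i, a⟩ ⟨k, b⟩
  simp only [lowerToeplitz, blockMat, Matrix.of_apply, Matrix.one_apply, ← constSeries_one,
    matCoeff_constSeries, Prod.mk.injEq]
  by_cases hik : i = k
  · simp [hik, Matrix.one_apply]
  · have : (i : ℕ) ≠ k := fun h => hik (Fin.ext h)
    rw [if_neg (show ¬(i = k ∧ a = b) from fun h => hik h.1)]
    split_ifs with h1 h2
    · omega
    · rfl
    · rfl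

theorem det_lowerToeplitz [Fintype m] [DecidableEq m] (N : ℕ) {F : Matrix m m ℂ⟦X⟧}
    (hF : matCoeff 0 F = 1) : (lowerToeplitz N F).det = 1 := by
  have htri : (lowerToeplitz N F)ᵀ.BlockTriangular (Prod.fst : Fin (N + 1) × m → Fin (N + 1)) := by
    rintro ⟨i, a⟩ ⟨k, b⟩ h
    have h' : ¬ i ≤ k := not_le.mpr h
    simp [lowerToeplitz, blockMat, h']
  rw [← Matrix.det_transpose, htri.det_fintype]
  refine Finset.prod_eq_one fun k _ => ?_
  have : (lowerToeplitz N F)ᵀ.toSquareBlock Prod.fst k = 1 := by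
    ext ⟨⟨i, a⟩, hi⟩ ⟨⟨j, b⟩, hj⟩
    obtain rfl : i = k := hi
    obtain rfl : j = i := hj
    simp [Matrix.toSquareBlock_def, lowerToeplitz, blockMat, hF, Matrix.one_apply, eq_comm]
  rw [this, Matrix.det_one]

theorem det_upperToeplitz [Fintype m] [DecidableEq m] (N : ℕ) {F : Matrix m m ℂ⟦X⟧}
    (hF : matCoeff 0 F = 1) : (upperToeplitz N F).det = 1 := by
  rw [upperToeplitz_eq_transpose, Matrix.det_transpose, det_lowerToeplitz]
  have : matCoeff 0 Fᵀ = (matCoeff 0 F)ᵀ := rfl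
  rw [this, hF, Matrix.transpose_one]

end Toeplitz

section Hankel

variable {m n : Type*} [Fintype m] [Fintype n]

/-- The `(j, k)` block of the product of a lower triangular block Toeplitz, a block Hankel and
an upper triangular block Toeplitz matrix. -/
def hankelConv (d : ℕ → Matrix m m ℂ) (a : ℕ → Matrix m n ℂ) (e : ℕ → Matrix n n ℂ)
    (j k : ℕ) : Matrix m n ℂ :=
  ∑ i ∈ range (j + 1), ∑ l ∈ range (k + 1), d (j - i) * a (i + l) * e (k - l)

theorem hankelConv_succ_left (d : ℕ → Matrix m m ℂ) (a : ℕ → Matrix m n ℂ)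
    (e : ℕ → Matrix n n ℂ) (j k : ℕ) :
    hankelConv d a e (j + 1) k = hankelConv d (fun i => a (i + 1)) e j k +
      d (j + 1) * ∑ l ∈ range (k + 1), a l * e (k - l) := by
  rw [hankelConv, Finset.sum_range_succ', hankelConv, Matrix.mul_sum]
  congr 1
  · refine Finset.sum_congr rfl fun i _ => Finset.sum_congr rfl fun l _ => ?_
    rw [Nat.add_sub_add_right, add_right_comm]
  · refine Finset.sum_congr rfl fun l _ => ?_
    rw [zero_add, Nat.sub_zero, Matrix.mul_assoc]

theorem hankelConv_succ_right (d : ℕ → Matrix m m ℂ) (a : ℕ → Matrix m n ℂ)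
    (e : ℕ → Matrix n n ℂ) (j k : ℕ) :
    hankelConv d a e j (k + 1) = hankelConv d (fun i => a (i + 1)) e j k +
      (∑ i ∈ range (j + 1), d (j - i) * a i) * e (k + 1) := by
  rw [hankelConv, hankelConv, Matrix.sum_mul, ← Finset.sum_add_distrib]
  refine Finset.sum_congr rfl fun i _ => ?_
  rw [Finset.sum_range_succ']
  congr 1
  refine Finset.sum_congr rfl fun l _ => ?_
  rw [Nat.add_sub_add_right, add_assoc]

theorem hankelConv_shift {d : ℕ → Matrix m m ℂ} {a : ℕ → Matrix m n ℂ}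
    {e : ℕ → Matrix n n ℂ} {c : Matrix m n ℂ}
    (hda : ∀ j, ∑ i ∈ range (j + 1), d (j - i) * a i = if j = 0 then c else 0)
    (hae : ∀ k, ∑ l ∈ range (k + 1), a l * e (k - l) = if k = 0 then c else 0)
    (j k : ℕ) :
    hankelConv d (fun i => a (i + 1)) e j k = -(d (j + k + 1) * c) := by
  induction k generalizing j with
  | zero =>
    have h1 := hankelConv_succ_left d a e j 0
    have h2 : hankelConv d a e (j + 1) 0 = 0 := by
      simp only [hankelConv, zero_add, Finset.sum_range_one, Nat.sub_self, add_zero]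
      rw [← Matrix.sum_mul, hda (j + 1), if_neg (by omega), Matrix.zero_mul]
    rw [h2, hae, if_pos rfl] at h1
    exact eq_neg_of_add_eq_zero_left h1.symm
  | succ k ih =>
    have h1 := hankelConv_succ_left d a e j (k + 1)
    have h2 := hankelConv_succ_right d a e (j + 1) k
    rw [hae, if_neg (by omega), Matrix.mul_zero, add_zero] at h1
    rw [hda, if_neg (by omega), Matrix.zero_mul, add_zero] at h2
    rw [← h1, h2, ih, show j + 1 + k + 1 = j + (k + 1) + 1 by omega]

theorem lowerToeplitz_mul_blockMat_mul_upperToeplitz (N : ℕ) (D : Matrix m m ℂ⟦X⟧)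
    (E : Matrix n n ℂ⟦X⟧) (a : ℕ → Matrix m n ℂ) :
    lowerToeplitz N D * blockMat N (fun j k => a (j + k)) * upperToeplitz N E =
      blockMat N (hankelConv (fun i => matCoeff i D) a (fun i => matCoeff i E)) := by
  rw [lowerToeplitz, upperToeplitz, blockMat_mul, blockMat_mul]
  refine blockMat_congr fun j hj k hk => ?_
  rw [hankelConv, Finset.sum_congr rfl fun l _ => show _ = if l ≤ k then
      ∑ i ∈ range (j + 1), matCoeff (j - i) D * a (i + l) * matCoeff (k - l) E else 0 from ?_,
    sum_range_ite_le hk, Finset.sum_comm]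
  split_ifs with h
  · rw [← sum_range_ite_le hj, Matrix.sum_mul]
    refine Finset.sum_congr rfl fun i _ => ?_
    split_ifs <;> simp
  · rw [Matrix.mul_zero]

end Hankel

section Reciprocal

variable {p q : ℕ}

theorem recip_zero (s : ℕ → Matrix (Fin p) (Fin q) ℂ) : recip s 0 = mp (s 0) := by
  rw [recip]

theorem recip_succ (s : ℕ → Matrix (Fin p) (Fin q) ℂ) (j : ℕ) :
    recip s (j + 1) = -(mp (s 0) * ∑ l ∈ range (j + 1), s (j + 1 - l) * recip s l) := by
  rw [recip, Finset.sum_range]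

theorem mp_mul_mul_recip (s : ℕ → Matrix (Fin p) (Fin q) ℂ) (j : ℕ) :
    mp (s 0) * s 0 * recip s j = recip s j := by
  cases j with
  | zero => rw [recip_zero, mp_mul_mul_mp]
  | succ j => rw [recip_succ, Matrix.mul_neg, ← Matrix.mul_assoc, mp_mul_mul_mp]

theorem recip_mul_mul_mp (s : ℕ → Matrix (Fin p) (Fin q) ℂ) (j : ℕ) :
    recip s j * (s 0 * mp (s 0)) = recip s j := by
  induction j using Nat.strong_induction_on with
  | _ j ih =>
    cases j with
    | zero => rw [recip_zero, ← Matrix.mul_assoc, mp_mul_mul_mp]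
    | succ j =>
      rw [recip_succ, Matrix.neg_mul, Matrix.mul_assoc, Matrix.sum_mul]
      congr 2
      refine Finset.sum_congr rfl fun l hl => ?_
      rw [Matrix.mul_assoc, ih l (by simpa using hl)]

/-- The compression of a sequence to the range and corange of its first term. -/
noncomputable def compress (s : ℕ → Matrix (Fin p) (Fin q) ℂ) :
    ℕ → Matrix (Fin p) (Fin q) ℂ :=
  fun j => s 0 * mp (s 0) * s j * (mp (s 0) * s 0)

theorem compress_zero (s : ℕ → Matrix (Fin p) (Fin q) ℂ) : compress s 0 = s 0 := by
  rw [compress, mul_mp_mul_self, ← Matrix.mul_assoc, mul_mp_mul_self]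

theorem recip_compress (s : ℕ → Matrix (Fin p) (Fin q) ℂ) : recip (compress s) = recip s := by
  funext j
  induction j using Nat.strong_induction_on with
  | _ j ih =>
    cases j with
    | zero => rw [recip_zero, recip_zero, compress_zero]
    | succ j =>
      rw [recip_succ, recip_succ, compress_zero, Matrix.mul_sum, Matrix.mul_sum]
      congr 1
      refine Finset.sum_congr rfl fun l hl => ?_
      rw [ih l (by simpa using hl), compress]
      calc mp (s 0) * (s 0 * mp (s 0) * s (j + 1 - l) * (mp (s 0) * s 0) * recip s l)
          = mp (s 0) * s 0 * mp (s 0) * s (j + 1 - l) * (mp (s 0) * s 0 * recip s l) := by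
            simp only [Matrix.mul_assoc]
        _ = _ := by rw [mp_mul_mul_mp, mp_mul_mul_recip, Matrix.mul_assoc]

theorem shiftA_compress (α : ℂ) (s : ℕ → Matrix (Fin p) (Fin q) ℂ) :
    shiftA α (compress s) = compress (shiftA α s) := by
  funext j
  cases j with
  | zero => exact (compress_zero s).trans (compress_zero (shiftA α s)).symm
  | succ j =>
    simp only [shiftA, compress, Matrix.mul_add, Matrix.add_mul, Matrix.mul_smul, Matrix.smul_mul]

theorem schur1_compress (α : ℂ) (s : ℕ → Matrix (Fin p) (Fin q) ℂ) :
    schur1 α (compress s) = schur1 α s := by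
  funext j
  rw [schur1, schur1, recipA, recipA, shiftA_compress, recip_compress, compress_zero]

theorem Dl_compress (α : ℂ) (s : ℕ → Matrix (Fin p) (Fin q) ℂ) (n : ℕ) :
    Dl α (compress s) n = Dl α s n := by
  rw [Dl, Dl, SlowMP, SlowMP, recip_compress, compress_zero]

theorem Dr_compress (α : ℂ) (s : ℕ → Matrix (Fin p) (Fin q) ℂ) (n : ℕ) :
    Dr α (compress s) n = Dr α s n := by
  rw [Dr, Dr, SupMP, SupMP, recip_compress, compress_zero]

theorem genSeries_mul_recip {s : ℕ → Matrix (Fin p) (Fin q) ℂ}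
    (hP : ∀ j, s 0 * mp (s 0) * s j = s j) :
    genSeries s * genSeries (recip s) = constSeries (s 0 * mp (s 0)) := by
  refine matCoeff_ext fun k => ?_
  rw [matCoeff_mul_right, matCoeff_constSeries]
  simp only [matCoeff_genSeries]
  cases k with
  | zero => simp [recip_zero]
  | succ k =>
    rw [Finset.sum_range_succ, recip_succ, Nat.sub_self, Matrix.mul_neg, ← Matrix.mul_assoc,
      Matrix.mul_sum, if_neg (by omega)]
    simp only [← Matrix.mul_assoc, hP, add_neg_cancel]

theorem eq_zero_of_genSeries_mul_eq_zero {l : Type*} {s : ℕ → Matrix (Fin p) (Fin q) ℂ}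
    {F : Matrix (Fin q) l ℂ⟦X⟧} (h : genSeries s * F = 0)
    (hF : constSeries (mp (s 0) * s 0) * F = F) : F = 0 := by
  refine matCoeff_ext fun k => ?_
  have hz : ∀ k, matCoeff k (0 : Matrix (Fin q) l ℂ⟦X⟧) = 0 := fun k => by
    ext; simp [matCoeff]
  rw [hz]
  induction k using Nat.strong_induction_on with
  | _ k ih =>
    have h1 := congrArg (matCoeff k) h
    rw [matCoeff_mul_right, Finset.sum_range_succ, Finset.sum_eq_zero, zero_add, Nat.sub_self,
      matCoeff_genSeries] at h1
    · rw [← hF, matCoeff_constSeries_mul, Matrix.mul_assoc, h1]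
      ext; simp [matCoeff]
    · intro i hi
      rw [ih i (by simpa using hi), Matrix.mul_zero]

theorem constSeries_mul_genSeries_recip (s : ℕ → Matrix (Fin p) (Fin q) ℂ) :
    constSeries (mp (s 0) * s 0) * genSeries (recip s) = genSeries (recip s) :=
  matCoeff_ext fun k => by
    rw [matCoeff_constSeries_mul, matCoeff_genSeries, mp_mul_mul_recip]

theorem genSeries_recip_mul_constSeries (s : ℕ → Matrix (Fin p) (Fin q) ℂ) :
    genSeries (recip s) * constSeries (s 0 * mp (s 0)) = genSeries (recip s) :=
  matCoeff_ext fun k => by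
    rw [matCoeff_mul_constSeries, matCoeff_genSeries, recip_mul_mul_mp]

theorem genSeries_recip_mul {s : ℕ → Matrix (Fin p) (Fin q) ℂ}
    (hP : ∀ j, s 0 * mp (s 0) * s j = s j) (hQ : ∀ j, s j * (mp (s 0) * s 0) = s j) :
    genSeries (recip s) * genSeries s = constSeries (mp (s 0) * s 0) := by
  rw [← sub_eq_zero]
  have hPS : constSeries (s 0 * mp (s 0)) * genSeries s = genSeries s :=
    matCoeff_ext fun k => by rw [matCoeff_constSeries_mul, matCoeff_genSeries, hP]
  have hQS : genSeries s * constSeries (mp (s 0) * s 0) = genSeries s :=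
    matCoeff_ext fun k => by rw [matCoeff_mul_constSeries, matCoeff_genSeries, hQ]
  apply eq_zero_of_genSeries_mul_eq_zero (s := s)
  · rw [Matrix.mul_sub, ← Matrix.mul_assoc, genSeries_mul_recip hP, hPS, hQS, sub_self]
  · rw [Matrix.mul_sub, ← Matrix.mul_assoc, constSeries_mul_genSeries_recip, ← constSeries_mul,
      ← Matrix.mul_assoc, mp_mul_mul_mp]

end Reciprocal

section Factorization

variable {p q : ℕ}

theorem one_sub_C_mul_X_mul_inv (α : ℂ) :
    (1 - PowerSeries.C α * X : ℂ⟦X⟧) * (1 - PowerSeries.C α * X)⁻¹ = 1 :=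
  PowerSeries.mul_inv_cancel _ (by simp)

theorem genSeries_shiftA (α : ℂ) (s : ℕ → Matrix (Fin p) (Fin q) ℂ) :
    genSeries (shiftA α s) = (1 - PowerSeries.C α * X : ℂ⟦X⟧) • genSeries s := by
  ext i j k
  cases k with
  | zero => simp [genSeries, shiftA, sub_mul, mul_assoc]
  | succ k =>
    simp [genSeries, shiftA, sub_mul, mul_assoc, PowerSeries.coeff_succ_X_mul]
    ring

theorem genSeries_recipA (α : ℂ) {s : ℕ → Matrix (Fin p) (Fin q) ℂ}
    (hP : ∀ j, s 0 * mp (s 0) * s j = s j) (hQ : ∀ j, s j * (mp (s 0) * s 0) = s j) :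
    genSeries (recipA α s) = (1 - PowerSeries.C α * X : ℂ⟦X⟧)⁻¹ • genSeries (recip s) := by
  have hP' : ∀ j, shiftA α s 0 * mp (shiftA α s 0) * shiftA α s j = shiftA α s j := by
    intro j
    cases j with
    | zero => exact hP 0
    | succ j => simp only [shiftA, Matrix.mul_add, Matrix.mul_smul, hP]
  have h1 := genSeries_mul_recip hP'
  have h2 := constSeries_mul_genSeries_recip (shiftA α s)
  rw [genSeries_shiftA] at h1
  change (_ • genSeries s) * genSeries (recipA α s) = constSeries (s 0 * mp (s 0)) at h1
  change constSeries (mp (s 0) * s 0) * genSeries (recipA α s) = genSeries (recipA α s) at h2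
  calc genSeries (recipA α s)
      = genSeries (recip s) * (genSeries s * genSeries (recipA α s)) := by
        rw [← Matrix.mul_assoc, genSeries_recip_mul hP hQ, h2]
    _ = (1 - PowerSeries.C α * X : ℂ⟦X⟧)⁻¹ • (genSeries (recip s) *
          (((1 - PowerSeries.C α * X : ℂ⟦X⟧) • genSeries s) * genSeries (recipA α s))) := by
        rw [Matrix.smul_mul, Matrix.mul_smul, smul_smul, mul_comm _ (1 - _),
          one_sub_C_mul_X_mul_inv, one_smul]
    _ = _ := by rw [h1, genSeries_recip_mul_constSeries]

theorem kronI_eq_lowerToeplitz {a b : ℕ} (n : ℕ) (M : Matrix (Fin a) (Fin b) ℂ) :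
    kronI n M = lowerToeplitz n (constSeries M) := by
  ext ⟨i, x⟩ ⟨k, y⟩
  simp only [kronI, lowerToeplitz, blockMat, Matrix.of_apply, matCoeff_constSeries]
  by_cases hik : i = k
  · simp [hik]
  · have : (i : ℕ) ≠ k := fun h => hik (Fin.ext h)
    rw [if_neg hik]
    split_ifs with h1 h2
    · omega
    · rfl
    · rfl

theorem kronI_transpose {a b : ℕ} (n : ℕ) (M : Matrix (Fin a) (Fin b) ℂ) :
    (kronI n M)ᵀ = kronI n Mᵀ := by
  ext ⟨i, x⟩ ⟨k, y⟩
  simp [kronI, eq_comm]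

theorem kronI_eq_upperToeplitz {a b : ℕ} (n : ℕ) (M : Matrix (Fin a) (Fin b) ℂ) :
    kronI n M = upperToeplitz n (constSeries M) := by
  rw [upperToeplitz_eq_transpose, ← Matrix.transpose_transpose (kronI n M), kronI_transpose,
    kronI_eq_lowerToeplitz]
  rfl

theorem SlowMP_eq_lowerToeplitz (s : ℕ → Matrix (Fin p) (Fin q) ℂ) (n : ℕ) :
    SlowMP s n = lowerToeplitz n (genSeries (recip s)) := by
  ext ⟨i, x⟩ ⟨k, y⟩
  simp only [SlowMP, lowerToeplitz, blockMat, Matrix.of_apply, matCoeff_genSeries]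
  split_ifs <;> rfl

theorem SupMP_eq_upperToeplitz (s : ℕ → Matrix (Fin p) (Fin q) ℂ) (n : ℕ) :
    SupMP s n = upperToeplitz n (genSeries (recip s)) := by
  ext ⟨i, x⟩ ⟨k, y⟩
  simp only [SupMP, upperToeplitz, blockMat, Matrix.of_apply, matCoeff_genSeries]
  split_ifs <;> rfl

theorem one_sub_smul_Tshift (n : ℕ) (z : ℂ) :
    1 - z • Tshift p n =
      lowerToeplitz n ((1 - PowerSeries.C z * X : ℂ⟦X⟧) • (1 : Matrix (Fin p) (Fin p) ℂ⟦X⟧)) := by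
  ext ⟨i, x⟩ ⟨k, y⟩
  simp only [lowerToeplitz, blockMat, Matrix.of_apply, Matrix.sub_apply, Matrix.smul_apply, Tshift,
    Matrix.one_apply, Prod.mk.injEq, matCoeff, smul_eq_mul]
  by_cases hxy : x = y
  · subst hxy
    by_cases hki : (k : ℕ) ≤ i
    · obtain ⟨d, hd⟩ := Nat.exists_eq_add_of_le hki
      rw [if_pos hki, show (i : ℕ) - k = d by omega]
      rcases d with _ | _ | d
      · have : i = k := Fin.ext (by omega)
        simp [this]
      · have : i ≠ k := fun h => by subst h; omega
        simp [this, hd, PowerSeries.coeff_one]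
      · have : i ≠ k := fun h => by subst h; omega
        simp [this, hd, PowerSeries.coeff_one]
    · have h1 : i ≠ k := fun h => by subst h; omega
      have h2 : (i : ℕ) ≠ k + 1 := by omega
      simp [hki, h1, h2]
  · split_ifs <;> simp_all

theorem Rmat_eq_lowerToeplitz (n : ℕ) (z : ℂ) :
    Rmat p n z = lowerToeplitz n
      ((1 - PowerSeries.C z * X : ℂ⟦X⟧)⁻¹ • (1 : Matrix (Fin p) (Fin p) ℂ⟦X⟧)) := by
  rw [Rmat, one_sub_smul_Tshift]
  refine Matrix.inv_eq_right_inv ?_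
  rw [← lowerToeplitz_mul, Matrix.smul_mul, Matrix.one_mul, smul_smul, one_sub_C_mul_X_mul_inv,
    one_smul, lowerToeplitz_one]

theorem conjTranspose_Rmat_conj (n : ℕ) (z : ℂ) :
    (Rmat p n (starRingEnd ℂ z))ᴴ = upperToeplitz n
      ((1 - PowerSeries.C z * X : ℂ⟦X⟧)⁻¹ • (1 : Matrix (Fin p) (Fin p) ℂ⟦X⟧)) := by
  have hT : (Tshift p n)ᴴ = (Tshift p n)ᵀ := by
    ext x y
    simp only [Tshift, Matrix.conjTranspose_apply, Matrix.transpose_apply, Matrix.of_apply]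
    split_ifs <;> simp
  rw [upperToeplitz_eq_transpose, Matrix.transpose_smul, Matrix.transpose_one,
    ← Rmat_eq_lowerToeplitz, Rmat, Rmat, Matrix.conjTranspose_nonsing_inv,
    Matrix.transpose_nonsing_inv]
  simp [hT]

/-- The matrix series whose lower block Toeplitz matrix is `Dl`. -/
noncomputable def DlSeries (α : ℂ) (s : ℕ → Matrix (Fin p) (Fin q) ℂ) :
    Matrix (Fin p) (Fin p) ℂ⟦X⟧ :=
  (1 - PowerSeries.C α * X : ℂ⟦X⟧)⁻¹ • (constSeries (s 0) * genSeries (recip s)) +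
    constSeries (1 - s 0 * mp (s 0))

/-- The matrix series whose upper block Toeplitz matrix is `Dr`. -/
noncomputable def DrSeries (α : ℂ) (s : ℕ → Matrix (Fin p) (Fin q) ℂ) :
    Matrix (Fin q) (Fin q) ℂ⟦X⟧ :=
  (1 - PowerSeries.C α * X : ℂ⟦X⟧)⁻¹ • (genSeries (recip s) * constSeries (s 0)) +
    constSeries (1 - mp (s 0) * s 0)

theorem Dl_eq_lowerToeplitz (α : ℂ) (s : ℕ → Matrix (Fin p) (Fin q) ℂ) (n : ℕ) :
    Dl α s n = lowerToeplitz n (DlSeries α s) := by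
  rw [Dl, Rmat_eq_lowerToeplitz, kronI_eq_lowerToeplitz, kronI_eq_lowerToeplitz,
    SlowMP_eq_lowerToeplitz, ← lowerToeplitz_mul, ← lowerToeplitz_mul, ← lowerToeplitz_add,
    DlSeries, Matrix.smul_mul, Matrix.one_mul, Matrix.smul_mul]

theorem Dr_eq_upperToeplitz (α : ℂ) (s : ℕ → Matrix (Fin p) (Fin q) ℂ) (n : ℕ) :
    Dr α s n = upperToeplitz n (DrSeries α s) := by
  rw [Dr, conjTranspose_Rmat_conj, kronI_eq_upperToeplitz, kronI_eq_upperToeplitz,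
    SupMP_eq_upperToeplitz, ← upperToeplitz_mul, ← upperToeplitz_mul, ← upperToeplitz_add,
    DrSeries, Matrix.mul_smul, Matrix.mul_one]

theorem matCoeff_zero_smul {l m : Type*} (f : ℂ⟦X⟧) (F : Matrix l m ℂ⟦X⟧) :
    matCoeff 0 (f • F) = constantCoeff f • matCoeff 0 F := by
  ext i j
  simp [matCoeff]

theorem det_Dl (α : ℂ) (s : ℕ → Matrix (Fin p) (Fin q) ℂ) (n : ℕ) : (Dl α s n).det = 1 := by
  rw [Dl_eq_lowerToeplitz]
  apply det_lowerToeplitz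
  simp [DlSeries, matCoeff_zero_smul, matCoeff_constSeries, recip_zero]

theorem det_Dr (α : ℂ) (s : ℕ → Matrix (Fin p) (Fin q) ℂ) (n : ℕ) : (Dr α s n).det = 1 := by
  rw [Dr_eq_upperToeplitz]
  apply det_upperToeplitz
  simp [DrSeries, matCoeff_zero_smul, matCoeff_constSeries, recip_zero]

/-- The factorization for a sequence all of whose terms are dominated by the first one. -/
theorem hankelMat_schur1_of_dominant (α : ℂ) {s : ℕ → Matrix (Fin p) (Fin q) ℂ}
    (hP : ∀ j, s 0 * mp (s 0) * s j = s j) (hQ : ∀ j, s j * (mp (s 0) * s 0) = s j) (n : ℕ) :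
    hankelMat (schur1 α s) n = Dl α s n * hankelMat (sA α s) n * Dr α s n := by
  have hDA : DlSeries α s * genSeries (shiftA α s) = constSeries (s 0) := by
    rw [genSeries_shiftA, DlSeries, Matrix.add_mul, Matrix.mul_smul, Matrix.smul_mul, smul_smul,
      one_sub_C_mul_X_mul_inv, one_smul, Matrix.mul_assoc, genSeries_recip_mul hP hQ,
      ← constSeries_mul, hQ, Matrix.mul_smul]
    have : constSeries (1 - s 0 * mp (s 0)) * genSeries s = 0 := by
      refine matCoeff_ext fun k => ?_
      rw [matCoeff_constSeries_mul, matCoeff_genSeries, Matrix.sub_mul, hP, Matrix.one_mul,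
        sub_self]
      ext; simp [matCoeff]
    rw [this, smul_zero, add_zero]
  have hAE : genSeries (shiftA α s) * DrSeries α s = constSeries (s 0) := by
    rw [genSeries_shiftA, DrSeries, Matrix.mul_add, Matrix.mul_smul, Matrix.smul_mul, smul_smul,
      mul_comm _ (1 - _), one_sub_C_mul_X_mul_inv, one_smul, ← Matrix.mul_assoc,
      genSeries_mul_recip hP, ← constSeries_mul, hP, Matrix.smul_mul]
    have : genSeries s * constSeries (1 - mp (s 0) * s 0) = 0 := by
      refine matCoeff_ext fun k => ?_
      rw [matCoeff_mul_constSeries, matCoeff_genSeries, Matrix.mul_sub, hQ, Matrix.mul_one,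
        sub_self]
      ext; simp [matCoeff]
    rw [this, smul_zero, add_zero]
  have hD : DlSeries α s * constSeries (s 0) =
      constSeries (s 0) * genSeries (recipA α s) * constSeries (s 0) := by
    rw [DlSeries, Matrix.add_mul, ← constSeries_mul, Matrix.sub_mul, hP, Matrix.one_mul, sub_self,
      constSeries, constSeries, Matrix.map_zero _ (map_zero _), add_zero,
      genSeries_recipA α hP hQ, Matrix.mul_smul]
  have hblock : ∀ a : ℕ → Matrix (Fin p) (Fin q) ℂ,
      hankelMat a n = blockMat n fun j k => a (j + k) := fun _ => rfl
  have hsA : sA α s = fun i => matCoeff (i + 1) (genSeries (shiftA α s)) := by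
    funext i
    rw [matCoeff_genSeries]
    rfl
  rw [Dl_eq_lowerToeplitz, Dr_eq_upperToeplitz, hblock, hblock,
    lowerToeplitz_mul_blockMat_mul_upperToeplitz n _ _ (sA α s), hsA]
  refine blockMat_congr fun j _ k _ => ?_
  rw [hankelConv_shift (a := fun i => matCoeff i (genSeries (shiftA α s))) (c := s 0)]
  · rw [← matCoeff_mul_constSeries, hD, matCoeff_mul_constSeries, matCoeff_constSeries_mul,
      matCoeff_genSeries, schur1, Matrix.mul_neg, Matrix.neg_mul]
  · intro j
    rw [← matCoeff_mul_right, hDA, matCoeff_constSeries]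
  · intro k
    rw [← matCoeff_mul_left, hAE, matCoeff_constSeries]

theorem compress_mul_mp (s : ℕ → Matrix (Fin p) (Fin q) ℂ) (j : ℕ) :
    compress s 0 * mp (compress s 0) * compress s j = compress s j := by
  rw [compress_zero, compress]
  simp only [← Matrix.mul_assoc, mul_mp_mul_self]

theorem compress_mp_mul (s : ℕ → Matrix (Fin p) (Fin q) ℂ) (j : ℕ) :
    compress s j * (mp (compress s 0) * compress s 0) = compress s j := by
  rw [compress_zero, compress, Matrix.mul_assoc, ← Matrix.mul_assoc (mp (s 0) * s 0),
    mp_mul_mul_mp]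

theorem hankelMat_sub_theta (α : ℂ) {s : ℕ → Matrix (Fin p) (Fin q) ℂ} {n : ℕ}
    (h : ∀ j ≤ 2 * n, compress s j = s j) :
    hankelMat (sA α s) n - theta s n (2 * n + 1) = hankelMat (sA α (compress s)) n := by
  ext ⟨i, x⟩ ⟨k, y⟩
  simp only [hankelMat, theta, sA, Matrix.sub_apply, Matrix.of_apply, Matrix.add_apply,
    Matrix.smul_apply]
  by_cases hik : i.val = n ∧ k.val = n
  · rw [if_pos hik, hik.1, hik.2, ← two_mul, h _ le_rfl, compress]
    simp only [Matrix.mul_assoc]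
    ring
  · rw [if_neg hik, h _ (by omega), h _ (by omega), sub_zero]

theorem det_hankelMat_sA_compress (α : ℂ) {s : ℕ → Matrix (Fin p) (Fin p) ℂ} (n : ℕ)
    (h : (s 0).det = 0) : (hankelMat (sA α (compress s)) n).det = 0 := by
  obtain ⟨v, hv, hsv⟩ := Matrix.exists_mulVec_eq_zero_iff.mpr h
  refine Matrix.exists_mulVec_eq_zero_iff.mp
    ⟨fun x => v x.2, fun h0 => hv (funext fun i => congrFun h0 (0, i)), ?_⟩
  have hz : ∀ j, sA α (compress s) j *ᵥ v = 0 := by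
    intro j
    have hc : ∀ j, compress s j *ᵥ v = 0 := fun j => by
      rw [compress, ← mulVec_mulVec, ← mulVec_mulVec v (mp (s 0)) (s 0), hsv, mulVec_zero, mulVec_zero]
    simp only [sA, Matrix.add_mulVec, Matrix.smul_mulVec, hc, smul_zero, add_zero]
  ext ⟨i, x⟩
  simp only [mulVec, dotProduct, hankelMat, Matrix.of_apply, Fintype.sum_prod_type]
  refine Finset.sum_eq_zero fun k _ => ?_
  exact congrFun (hz (i + k)) x

theorem theta_eq_zero_of_det_ne_zero {s : ℕ → Matrix (Fin p) (Fin p) ℂ} (h : (s 0).det ≠ 0)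
    (n m : ℕ) : theta s n m = 0 := by
  have hu : IsUnit (s 0).det := isUnit_iff_ne_zero.mpr h
  have h1 : s 0 * mp (s 0) = 1 := by
    have := congrArg (· * (s 0)⁻¹) (mul_mp_mul_self (s 0))
    simpa [Matrix.mul_nonsing_inv_cancel_right _ _ hu, Matrix.mul_nonsing_inv _ hu] using this
  have h2 : mp (s 0) * s 0 = 1 := mul_eq_one_comm.mp h1
  ext x y
  simp [theta, h1, Matrix.mul_assoc, h2]

end Factorization

end

/-- Lemma 6.10: factorization, rank and determinant identities for the block
    Hankel matrix of the first α-Schur transform of a nearly first-term dominant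
    sequence (s_j)_{j=0}^{2n+1}. -/
theorem stmt9 {p q : ℕ} (α : ℂ) (n : ℕ) (s : ℕ → Matrix (Fin p) (Fin q) ℂ)
    (hnftd : ∀ j : ℕ, j ≤ 2 * n →
      LinearMap.ker (Matrix.mulVecLin (s 0)) ≤ LinearMap.ker (Matrix.mulVecLin (s j)) ∧
      LinearMap.range (Matrix.mulVecLin (s j)) ≤ LinearMap.range (Matrix.mulVecLin (s 0))) :
    hankelMat (schur1 α s) n =
      Dl α s n * (hankelMat (sA α s) n - theta s n (2 * n + 1)) * Dr α s n ∧
    (hankelMat (schur1 α s) n).rank =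
      (hankelMat (sA α s) n - theta s n (2 * n + 1)).rank ∧
    (∀ h : p = q,
      ((hankelMat (schur1 α s) n).submatrix id
          (fun x : Fin (n + 1) × Fin p => (x.1, finCongr h x.2))).det =
        ((s 0).submatrix id (finCongr h)).det * (((s 0).submatrix id (finCongr h)).det)⁻¹ *
          ((hankelMat (sA α s) n).submatrix id
            (fun x : Fin (n + 1) × Fin p => (x.1, finCongr h x.2))).det ∧
      ((hankelMat (schur1 α s) n).submatrix id
          (fun x : Fin (n + 1) × Fin p => (x.1, finCongr h x.2))).det =
        (((hankelMat (sA α s) n - theta s n (2 * n + 1))).submatrix id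
          (fun x : Fin (n + 1) × Fin p => (x.1, finCongr h x.2))).det) := by
  have hc : ∀ j ≤ 2 * n, compress s j = s j := fun j hj => by
    rw [compress, mul_mp_mul_of_range_le (hnftd j hj).2, mul_mp_mul_of_ker_le (hnftd j hj).1]
  have hfac : hankelMat (schur1 α s) n =
      Dl α s n * (hankelMat (sA α s) n - theta s n (2 * n + 1)) * Dr α s n := by
    rw [hankelMat_sub_theta α hc, ← schur1_compress, ← Dl_compress, ← Dr_compress]
    exact hankelMat_schur1_of_dominant α (compress_mul_mp s) (compress_mp_mul s) n
  refine ⟨hfac, ?_, ?_⟩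
  · rw [hfac, Matrix.rank_mul_eq_left_of_isUnit_det _ _ (by rw [det_Dr]; exact isUnit_one),
      Matrix.rank_mul_eq_right_of_isUnit_det _ _ (by rw [det_Dl]; exact isUnit_one)]
  · rintro rfl
    have hdet : (hankelMat (schur1 α s) n).det =
        (hankelMat (sA α s) n - theta s n (2 * n + 1)).det := by
      rw [hfac, Matrix.det_mul, Matrix.det_mul, det_Dl, det_Dr, one_mul, mul_one]
    have key : (hankelMat (schur1 α s) n).det =
        (s 0).det * ((s 0).det)⁻¹ * (hankelMat (sA α s) n).det := by
      by_cases h0 : (s 0).det = 0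
      · rw [hdet, hankelMat_sub_theta α hc, det_hankelMat_sA_compress α n h0, h0, zero_mul,
          zero_mul]
      · rw [hdet, theta_eq_zero_of_det_ne_zero h0, sub_zero, mul_inv_cancel₀ h0, one_mul]
    exact ⟨key, hdet⟩
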